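/- arXiv:2410.01939 — 3 statements merged into one kernel-verified Lean document; each statement's English description precedes it below -/
import Mathlib

section
/- Let c : ℝⁿ → ℝ be a measurable function with c(x) ≥ 0 for all x, such that x ↦ exp(−c(x)) is Lebesgue-integrable, and such that for every δ > 0 the set {x : c(x) < δ} has strictly positive Lebesgue measure. For σ > 0 let μ_σ be the probability measure on ℝⁿ whose density with respect to Lebesgue measure is exp(−c(x)/σ²) / Z_σ, where Z_σ = ∫ exp(−c(x)/σ²) dx. Then for every ε > 0, μ_σ({x : c(x) ≥ ε}) → 0 as σ → 0⁺. (In particular, if X_σ ∼ μ_σ, then c(X_σ) converges in probability to 0 = inf c as σ → 0.) -/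
open MeasureTheory Filter Set

/-- Quantitative concentration of Gibbs measures: the mass of `{x | ε ≤ c x}` at noise level
`σ ≤ 1` is at most `exp (ε - (ε - δ) / σ²)` times a constant independent of `σ`. -/
theorem gibbs_superlevel_le {α : Type*} [MeasurableSpace α] {μ : Measure α} {c : α → ℝ}
    (hc : Measurable c) {δ ε σ : ℝ} (hσ : 0 < σ) (hσ1 : σ ≤ 1) :
    ((∫⁻ x, ENNReal.ofReal (Real.exp (-c x / σ ^ 2)) ∂μ)⁻¹ •
        μ.withDensity (fun x => ENNReal.ofReal (Real.exp (-c x / σ ^ 2)))) {x | ε ≤ c x} ≤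
      ENNReal.ofReal (Real.exp (ε - (ε - δ) * (σ ^ 2)⁻¹)) *
        ((∫⁻ x, ENNReal.ofReal (Real.exp (-c x)) ∂μ) * (μ {x | c x < δ})⁻¹) := by
  have ht : 1 ≤ (σ ^ 2)⁻¹ := (one_le_inv₀ (by positivity)).2 (pow_le_one₀ hσ.le hσ1)
  simp only [div_eq_mul_inv]
  generalize (σ ^ 2)⁻¹ = t at ht ⊢
  have hS : MeasurableSet {x | ε ≤ c x} := measurableSet_le measurable_const hc
  have hT : MeasurableSet {x | c x < δ} := measurableSet_lt hc measurable_const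
  have hnum : ∫⁻ x in {x | ε ≤ c x}, ENNReal.ofReal (Real.exp (-c x * t)) ∂μ ≤
      ENNReal.ofReal (Real.exp (-(ε * (t - 1)))) *
        ∫⁻ x, ENNReal.ofReal (Real.exp (-c x)) ∂μ := by
    rw [← lintegral_const_mul _ (by fun_prop)]
    refine (setLIntegral_mono (by fun_prop) fun x (hx : ε ≤ c x) => ?_).trans
      (setLIntegral_le_lintegral _ _)
    rw [← ENNReal.ofReal_mul (Real.exp_nonneg _), ← Real.exp_add]
    exact ENNReal.ofReal_le_ofReal (Real.exp_le_exp.2 (by nlinarith))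
  have hden : ENNReal.ofReal (Real.exp (-(δ * t))) * μ {x | c x < δ} ≤
      ∫⁻ x, ENNReal.ofReal (Real.exp (-c x * t)) ∂μ := by
    rw [← setLIntegral_const]
    refine (setLIntegral_mono (by fun_prop) fun x (hx : c x < δ) => ?_).trans
      (setLIntegral_le_lintegral _ _)
    exact ENNReal.ofReal_le_ofReal (Real.exp_le_exp.2 (by nlinarith))
  rw [Measure.smul_apply, smul_eq_mul, withDensity_apply _ hS]
  refine (mul_le_mul' (ENNReal.inv_le_inv.2 hden) hnum).trans_eq ?_
  rw [ENNReal.mul_inv (.inl (by simp [Real.exp_pos])) (.inl ENNReal.ofReal_ne_top),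
    ← ENNReal.ofReal_inv_of_pos (Real.exp_pos _), ← Real.exp_neg, neg_neg,
    show ε - (ε - δ) * t = δ * t + -(ε * (t - 1)) by ring, Real.exp_add,
    ENNReal.ofReal_mul (Real.exp_nonneg _)]
  ring

/-- Concentration of Gibbs measures `μ_σ` with density `exp (-c x / σ²) / Z_σ` on the set of
global minimizers of `c` as `σ → 0⁺`: the mass of `{x | ε ≤ c x}` tends to `0`. -/
theorem stmt_0 (n : ℕ) (c : EuclideanSpace ℝ (Fin n) → ℝ)
    (hc_meas : Measurable c) (hc_nonneg : ∀ x, 0 ≤ c x)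
    (hc_int : Integrable (fun x => Real.exp (-c x)))
    (hc_level : ∀ δ : ℝ, 0 < δ → 0 < volume {x | c x < δ}) :
    ∀ ε : ℝ, 0 < ε →
      Tendsto
        (fun σ : ℝ =>
          ((∫⁻ x, ENNReal.ofReal (Real.exp (-c x / σ ^ 2)))⁻¹ •
              volume.withDensity (fun x => ENNReal.ofReal (Real.exp (-c x / σ ^ 2))))
            {x | ε ≤ c x})
        (nhdsWithin 0 (Ioi 0)) (nhds 0) := by
  intro ε hε
  have hK : (∫⁻ x, ENNReal.ofReal (Real.exp (-c x))) * (volume {x | c x < ε / 2})⁻¹ ≠ ⊤ :=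
    ENNReal.mul_ne_top hc_int.lintegral_lt_top.ne
      (ENNReal.inv_ne_top.2 (hc_level _ (half_pos hε)).ne')
  have hsq : Tendsto (fun σ : ℝ => (σ ^ 2)⁻¹) (nhdsWithin 0 (Ioi 0)) atTop := by
    simpa only [inv_pow, Function.comp_def] using
      (tendsto_pow_atTop two_ne_zero).comp (tendsto_inv_nhdsGT_zero (𝕜 := ℝ))
  have hexp : Tendsto (fun σ : ℝ => Real.exp (ε - (ε - ε / 2) * (σ ^ 2)⁻¹))
      (nhdsWithin 0 (Ioi 0)) (nhds 0) := by
    refine Real.tendsto_exp_atBot.comp ?_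
    simp only [sub_eq_add_neg ε (_ * _)]
    exact tendsto_atBot_add_const_left _ _
      (tendsto_neg_atTop_atBot.comp (hsq.const_mul_atTop (by linarith)))
  have hbound := ENNReal.Tendsto.mul_const (ENNReal.tendsto_ofReal hexp) (.inr hK)
  rw [ENNReal.ofReal_zero, zero_mul] at hbound
  refine tendsto_of_tendsto_of_tendsto_of_le_of_le' tendsto_const_nhds hbound
    (Eventually.of_forall fun _ => zero_le) ?_
  filter_upwards [Ioc_mem_nhdsGT (zero_lt_one' ℝ)] with σ hσ
  exact gibbs_superlevel_le hc_meas hσ.1 hσ.2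
end

section
/- Let c : ℝⁿ → ℝ and h : ℝⁿ → ℝᵐ be twice continuously differentiable and let μ > 0. Define v(x,λ) = ∇c(x) + (Dh(x))*λ + μ (Dh(x))*(h(x)). Suppose x : ℝ → ℝⁿ and λ : ℝ → ℝᵐ are differentiable curves satisfying the deterministic (zero-noise) flow x′(t) = −v(x(t), λ(t)) and λ′(t) = μ h(x(t)). Define the energy E(t) = (1/2)‖v(x(t),λ(t))‖² + (μ/2)‖h(x(t))‖². Then E is differentiable and for every t, E′(t) = −⟨ v(x(t),λ(t)), A(t) v(x(t),λ(t)) ⟩, where A(t) is the Fréchet derivative at x(t) of the map y ↦ v(y, λ(t)) (i.e., A(t) = ∇²c + Σ_k λ_k ∇²h_k + μ (Dh)*(Dh) + μ Σ_k h_k ∇²h_k evaluated along the trajectory). -/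
open RealInnerProductSpace

/-- Over `ℝ`, conjugation is trivial, so a conjugate-linear isometry is differentiable. -/
theorem LinearIsometryEquiv.differentiable_of_conj {E F : Type*} [NormedAddCommGroup E] [NormedSpace ℝ E]
    [NormedAddCommGroup F] [NormedSpace ℝ F] (f : E ≃ₗᵢ⋆[ℝ] F) : Differentiable ℝ f := by
  have hf : IsBoundedLinearMap ℝ f :=
    ⟨⟨map_add f, fun a y => by simp⟩, 1, one_pos, fun y => by simp⟩
  exact hf.differentiable

theorem ContDiff.differentiable_gradient {F : Type*} [NormedAddCommGroup F]
    [InnerProductSpace ℝ F] [CompleteSpace F] {c : F → ℝ} (hc : ContDiff ℝ 2 c) :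
    Differentiable ℝ (gradient c) :=
  (LinearIsometryEquiv.differentiable_of_conj (InnerProductSpace.toDual ℝ F).symm).comp
    ((hc.fderiv_right (m := 1) (by norm_num)).differentiable (by norm_num))

theorem ContDiff.differentiable_adjoint_fderiv {F G : Type*} [NormedAddCommGroup F]
    [InnerProductSpace ℝ F] [CompleteSpace F] [NormedAddCommGroup G]
    [InnerProductSpace ℝ G] [CompleteSpace G] {h : F → G} (hh : ContDiff ℝ 2 h) :
    Differentiable ℝ (fun y => (fderiv ℝ h y).adjoint) :=
  (LinearIsometryEquiv.differentiable_of_conj (ContinuousLinearMap.adjoint (𝕜 := ℝ) (E := F) (F := G))).comp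
    ((hh.fderiv_right (m := 1) (by norm_num)).differentiable (by norm_num))

/-- Energy-dissipation identity for the zero-noise constrained differential-optimization flow
`x' = -v(x,λ)`, `λ' = μ h(x)`, with `v(x,λ) = ∇c x + (Dh x)* λ + μ (Dh x)* (h x)` and
energy `E = (1/2)‖v‖² + (μ/2)‖h‖²`: `E'(t) = -⟪v, A(t) v⟫`, where `A(t)` is the
Fréchet derivative of `y ↦ v(y, λ(t))` at `x(t)`. -/
theorem stmt_5 (n m : ℕ) (c : EuclideanSpace ℝ (Fin n) → ℝ)
    (h : EuclideanSpace ℝ (Fin n) → EuclideanSpace ℝ (Fin m))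
    (μ : ℝ) (hμ : 0 < μ) (hc : ContDiff ℝ 2 c) (hh : ContDiff ℝ 2 h)
    (v : EuclideanSpace ℝ (Fin n) → EuclideanSpace ℝ (Fin m) → EuclideanSpace ℝ (Fin n))
    (hv : ∀ y l, v y l =
      gradient c y + (fderiv ℝ h y).adjoint l + μ • (fderiv ℝ h y).adjoint (h y))
    (x : ℝ → EuclideanSpace ℝ (Fin n)) (lam : ℝ → EuclideanSpace ℝ (Fin m))
    (hx : ∀ t, HasDerivAt x (-(v (x t) (lam t))) t)
    (hlam : ∀ t, HasDerivAt lam (μ • h (x t)) t)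
    (E : ℝ → ℝ)
    (hE : ∀ t, E t = (1 / 2) * ‖v (x t) (lam t)‖ ^ 2 + (μ / 2) * ‖h (x t)‖ ^ 2) :
    ∀ t, HasDerivAt E
      (-⟪v (x t) (lam t),
          (fderiv ℝ (fun y => v y (lam t)) (x t)) (v (x t) (lam t))⟫) t := by
  intro t
  have hadj := hh.differentiable_adjoint_fderiv
  have hhd : Differentiable ℝ h := hh.differentiable (by norm_num)
  have hvd : Differentiable ℝ (fun y => v y (lam t)) := by
    simp only [hv]
    exact (hc.differentiable_gradient.add (hadj.clm_apply (differentiable_const _))).add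
      ((hadj.clm_apply hhd).const_smul μ)
  have hsplit : (fun s => v (x s) (lam s)) =
      fun s => v (x s) (lam t) + (fderiv ℝ h (x s)).adjoint (lam s - lam t) := by
    funext s
    simp only [hv, map_sub]
    abel
  have hV : HasDerivAt (fun s => v (x s) (lam s))
      (-(fderiv ℝ (fun y => v y (lam t)) (x t)) (v (x t) (lam t)) +
        μ • (fderiv ℝ h (x t)).adjoint (h (x t))) t := by
    rw [hsplit]
    have h₁ := (hvd (x t)).hasFDerivAt.comp_hasDerivAt t (hx t)
    have h₂ := ((hadj (x t)).hasFDerivAt.comp_hasDerivAt t (hx t)).clm_apply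
      ((hlam t).sub_const (lam t))
    refine (h₁.add h₂).congr_deriv ?_
    simp
  have hH : HasDerivAt (fun s => h (x s)) (-(fderiv ℝ h (x t)) (v (x t) (lam t))) t := by
    simpa [Function.comp_def] using (hhd (x t)).hasFDerivAt.comp_hasDerivAt t (hx t)
  rw [funext hE]
  refine ((hV.norm_sq.const_mul (1 / 2)).add (hH.norm_sq.const_mul (μ / 2))).congr_deriv ?_
  rw [inner_add_right, inner_neg_right, inner_neg_right, inner_smul_right,
    ContinuousLinearMap.adjoint_inner_right, real_inner_comm (h (x t))]
  ring
end

section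
/- Let c : ℝⁿ → ℝ and h : ℝⁿ → ℝᵐ be twice continuously differentiable and let μ > 0 and m > 0. Define v(x,λ) = ∇c(x) + (Dh(x))*λ + μ (Dh(x))*(h(x)). Suppose x : [0,∞) → ℝⁿ and λ : [0,∞) → ℝᵐ are differentiable curves satisfying x′(t) = −v(x(t), λ(t)) and λ′(t) = μ h(x(t)), that for every t ≥ 0 the Fréchet derivative A(t) of y ↦ v(y, λ(t)) at x(t) satisfies ⟨w, A(t) w⟩ ≥ m‖w‖² for all w ∈ ℝⁿ, and that the map t ↦ v(x(t), λ(t)) is uniformly continuous on [0, ∞). Then v(x(t), λ(t)) → 0 as t → ∞; equivalently, ∇c(x(t)) + (Dh(x(t)))*λ(t) + μ (Dh(x(t)))*(h(x(t))) converges to 0. -/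
open MeasureTheory Filter Set RealInnerProductSpace

/-- A Barbalat-type lemma: a uniformly continuous function whose squared norm is controlled by
the decay rate of a nonnegative energy tends to zero. -/
theorem tendsto_zero_of_energy_decay {F : Type*} [NormedAddCommGroup F] {V : ℝ → F}
    {E E' : ℝ → ℝ} {m : ℝ} (hm : 0 < m) (hE : ∀ t, 0 ≤ t → HasDerivAt E (E' t) t)
    (hE' : ∀ t, 0 ≤ t → E' t ≤ -(m * ‖V t‖ ^ 2)) (hnonneg : ∀ t, 0 ≤ E t)
    (hV : UniformContinuousOn V (Ici 0)) : Tendsto V atTop (nhds 0) := by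
  have drop : ∀ C a b : ℝ, 0 ≤ a → a ≤ b → (∀ t ∈ Icc a b, E' t ≤ C) →
      E b - E a ≤ C * (b - a) := by
    intro C a b ha hab hC
    refine (convex_Icc a b).image_sub_le_mul_sub_of_deriv_le
      (fun t ht => (hE t (ha.trans ht.1)).continuousAt.continuousWithinAt)
      (fun t ht => ?_) (fun t ht => ?_) a (left_mem_Icc.2 hab) b (right_mem_Icc.2 hab) hab
    · have ht' := interior_subset ht
      exact (hE t (ha.trans ht'.1)).differentiableAt.differentiableWithinAt
    · have ht' := interior_subset ht
      rw [(hE t (ha.trans ht'.1)).deriv]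
      exact hC t ht'
  have anti : Antitone fun t => E (max t 0) := by
    intro a b hab
    have key := drop 0 (max a 0) (max b 0) (le_max_right _ _) (max_le_max_right 0 hab)
      fun t ht => (hE' t ((le_max_right _ _).trans ht.1)).trans
        (neg_nonpos.2 (by positivity))
    simp only [zero_mul] at key
    exact sub_nonpos.1 key
  have lim := tendsto_atTop_ciInf anti ⟨0, by rintro _ ⟨t, rfl⟩; exact hnonneg _⟩
  rw [Metric.tendsto_atTop]
  intro ε hε
  obtain ⟨δ, hδ, hVδ⟩ := Metric.uniformContinuousOn_iff.1 hV (ε / 2) (half_pos hε)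
  have diff := lim.sub (lim.comp (tendsto_atTop_add_const_right atTop (δ / 2) tendsto_id))
  rw [sub_self] at diff
  have hpos : 0 < m * (ε / 2) ^ 2 * (δ / 2) := by positivity
  obtain ⟨N, hN⟩ := eventually_atTop.1 (diff.eventually_lt_const hpos)
  refine ⟨max N 0, fun t ht => ?_⟩
  have ht0 : 0 ≤ t := (le_max_right _ _).trans ht
  have small := hN t ((le_max_left _ _).trans ht)
  simp only [Function.comp_apply, id_eq, max_eq_left ht0,
    max_eq_left (show 0 ≤ t + δ / 2 by positivity)] at small
  by_contra! hbig
  rw [dist_zero_right] at hbig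
  have key := drop (-(m * (ε / 2) ^ 2)) t (t + δ / 2) ht0 (by linarith) fun s hs => by
    have hs0 : 0 ≤ s := ht0.trans hs.1
    have hd := hVδ t ht0 s hs0 (by
      rw [Real.dist_eq, abs_sub_comm, abs_of_nonneg (by linarith [hs.1])]
      linarith [hs.2])
    rw [dist_eq_norm] at hd
    have hVs : ε / 2 ≤ ‖V s‖ := by linarith [norm_sub_norm_le (V t) (V s)]
    refine (hE' s hs0).trans (neg_le_neg ?_)
    gcongr
  linarith

/-- Deterministic core of the paper's Theorem 2: along the zero-noise constrained
differential-optimization flow `x' = -v(x,λ)`, `λ' = μ h(x)` on `[0, ∞)` with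
`v(x,λ) = ∇c x + (Dh x)* λ + μ (Dh x)* (h x)`, if the Fréchet derivative `A(t)` of
`y ↦ v(y, λ(t))` at `x(t)` satisfies `⟪w, A(t) w⟫ ≥ m‖w‖²` for all `t ≥ 0`, and
`t ↦ v(x(t), λ(t))` is uniformly continuous on `[0, ∞)`, then `v(x(t), λ(t)) → 0`. -/
theorem stmt_13 (n mdim : ℕ) (c : EuclideanSpace ℝ (Fin n) → ℝ)
    (h : EuclideanSpace ℝ (Fin n) → EuclideanSpace ℝ (Fin mdim))
    (μ : ℝ) (hμ : 0 < μ) (m : ℝ) (hm : 0 < m)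
    (hc : ContDiff ℝ 2 c) (hh : ContDiff ℝ 2 h)
    (v : EuclideanSpace ℝ (Fin n) → EuclideanSpace ℝ (Fin mdim) → EuclideanSpace ℝ (Fin n))
    (hv : ∀ y l, v y l =
      gradient c y + (fderiv ℝ h y).adjoint l + μ • (fderiv ℝ h y).adjoint (h y))
    (x : ℝ → EuclideanSpace ℝ (Fin n)) (lam : ℝ → EuclideanSpace ℝ (Fin mdim))
    (hx : ∀ t, 0 ≤ t → HasDerivAt x (-(v (x t) (lam t))) t)
    (hlam : ∀ t, 0 ≤ t → HasDerivAt lam (μ • h (x t)) t)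
    (hA : ∀ t, 0 ≤ t → ∀ w : EuclideanSpace ℝ (Fin n),
      m * ‖w‖ ^ 2 ≤ ⟪w, (fderiv ℝ (fun y => v y (lam t)) (x t)) w⟫)
    (hucont : UniformContinuousOn (fun t => v (x t) (lam t)) (Ici 0)) :
    Tendsto (fun t => v (x t) (lam t)) atTop (nhds 0) := by
  have hDh : Differentiable ℝ (fderiv ℝ h) :=
    (hh.fderiv_right (m := 1) (by norm_num)).differentiable (by norm_num)
  have hB : Differentiable ℝ fun y => (fderiv ℝ h y).adjoint := fun y =>
    ((ContinuousLinearMap.adjoint (𝕜 := ℝ) (E := EuclideanSpace ℝ (Fin n))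
      (F := EuclideanSpace ℝ (Fin mdim))).toContinuousLinearEquiv.differentiable
        (fderiv ℝ h y)).comp y (hDh y)
  have hgrad : Differentiable ℝ (gradient c) := fun y =>
    ((InnerProductSpace.toDual ℝ (EuclideanSpace ℝ (Fin n))).symm.toContinuousLinearEquiv
      |>.differentiable (fderiv ℝ c y)).comp y
        ((hc.fderiv_right (m := 1) (by norm_num)).differentiable (by norm_num) y)
  have hhd : Differentiable ℝ h := hh.differentiable (by norm_num)
  have hvd : ∀ l, Differentiable ℝ fun y => v y l := by
    intro l
    simp only [hv]
    exact (hgrad.add (hB.clm_apply (differentiable_const l))).add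
      ((hB.clm_apply hhd).const_smul μ)
  have hV : ∀ t, 0 ≤ t → HasDerivAt (fun s => v (x s) (lam s))
      (fderiv ℝ (fun y => v y (lam t)) (x t) (-(v (x t) (lam t))) +
        (fderiv ℝ h (x t)).adjoint (μ • h (x t))) t := by
    intro t ht
    have h1 := (hvd (lam t) (x t)).hasFDerivAt.comp_hasDerivAt t (hx t ht)
    have h2 := ((hB (x t)).hasFDerivAt.comp_hasDerivAt t (hx t ht)).clm_apply
      ((hlam t ht).sub_const (lam t))
    refine ((h1.add h2).congr_deriv (by simp)).congr_of_eventuallyEq (.of_forall fun s => ?_)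
    simp only [Pi.add_apply, Function.comp_apply, hv, map_sub]
    abel
  refine tendsto_zero_of_energy_decay (m := m)
    (E := fun t => (1 / 2) * ‖v (x t) (lam t)‖ ^ 2 + μ / 2 * ‖h (x t)‖ ^ 2) hm
    (fun t ht => ((hV t ht).norm_sq.const_mul (1 / 2)).add
      (((hhd (x t)).hasFDerivAt.comp_hasDerivAt t (hx t ht)).norm_sq.const_mul (μ / 2)))
    (fun t ht => ?_) (fun t => by positivity) hucont
  have key := hA t ht (v (x t) (lam t))
  simp only [Function.comp_apply, map_neg, map_smul, inner_add_right, inner_neg_right,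
    inner_smul_right, ContinuousLinearMap.adjoint_inner_right]
  rw [real_inner_comm (h (x t))]
  linarith
end
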